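/- arXiv:2404.17228 — 7 statements merged into one kernel-verified Lean document; each statement's English description precedes it below -/
import Mathlib

section
/- Let Q : ℝ³ → ℝ be defined by Q(y) = 4(6+|y|²)/(2+|y|²)². Then Q satisfies the self-similar profile equation of the 3D Keller–Segel equation: for every y ∈ ℝ³, ΔQ(y) + ∇Q(y) · (4y/(2+|y|²)) + Q(y)² = Q(y) + (1/2)·(y · ∇Q(y)). Equivalently, writing φ(y) = 2·log(2+|y|²) (which satisfies Δφ = Q and ∇φ(y) = 4y/(2+|y|²)), Q satisfies ΔQ + ∇·(Q∇φ) = (1/2)ΛQ where Λf = 2f + y·∇f. -/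
open MeasureTheory Filter Matrix
open scoped RealInnerProductSpace BigOperators

noncomputable section

/-- `ℝ³` as a Euclidean space. -/
abbrev R3 := EuclideanSpace ℝ (Fin 3)

/-- The Laplacian `Δf = ∑ᵢ ∂²f/∂yᵢ²` of a function on `ℝ³` (valued in any normed space). -/
def lap {E : Type*} [NormedAddCommGroup E] [NormedSpace ℝ E] (f : R3 → E) (y : R3) : E :=
  ∑ i : Fin 3,
    fderiv ℝ (fun x => fderiv ℝ f x (EuclideanSpace.single i 1)) y (EuclideanSpace.single i 1)

/-- The explicit self-similar blowup profile of the 3D Keller–Segel equation. -/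
def Q (y : R3) : ℝ := 4 * (6 + ‖y‖ ^ 2) / (2 + ‖y‖ ^ 2) ^ 2

lemma hasFDerivAt_radial {g : ℝ → ℝ} {d : ℝ} (x : R3) (hg : HasDerivAt g d (‖x‖ ^ 2)) :
    HasFDerivAt (fun y : R3 => g (‖y‖ ^ 2)) (d • ((2 : ℝ) • innerSL ℝ x)) x := by
  have h := (hasStrictFDerivAt_norm_sq x).hasFDerivAt
  have h2 := hg.comp_hasFDerivAt x h
  refine h2.congr_fderiv ?_
  ext v
  simp [two_smul, two_mul]

lemma hasDerivAt_q (s : ℝ) (hs : 0 ≤ s) :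
    HasDerivAt (fun s : ℝ => 4 * (6 + s) / (2 + s) ^ 2) (-4 * (s + 10) / (2 + s) ^ 3) s := by
  have h0 : (2 + s) ≠ 0 := by positivity
  have h1 := (((hasDerivAt_id s).const_add 6).const_mul 4).div
    (((hasDerivAt_id s).const_add 2).pow 2) (by simpa using h0)
  refine h1.congr_deriv ?_
  simp
  field_simp
  ring

lemma hasDerivAt_q2 (s : ℝ) (hs : 0 ≤ s) :
    HasDerivAt (fun s : ℝ => -4 * (s + 10) / (2 + s) ^ 3) ((8 * s + 112) / (2 + s) ^ 4) s := by
  have h0 : (2 + s) ≠ 0 := by positivity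
  have h1 := (((hasDerivAt_id s).add_const 10).const_mul (-4)).div
    (((hasDerivAt_id s).const_add 2).pow 3) (by simpa using h0)
  refine h1.congr_deriv ?_
  simp
  field_simp
  ring

lemma hasFDerivAt_Q (x : R3) :
    HasFDerivAt Q ((-4 * (‖x‖ ^ 2 + 10) / (2 + ‖x‖ ^ 2) ^ 3) • ((2 : ℝ) • innerSL ℝ x)) x :=
  hasFDerivAt_radial x (hasDerivAt_q _ (by positivity))

lemma second_Q (y v : R3) :
    fderiv ℝ (fun x => fderiv ℝ Q x v) y v =
      (8 * ‖y‖ ^ 2 + 112) / (2 + ‖y‖ ^ 2) ^ 4 * (4 * ⟪y, v⟫ ^ 2)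
        + (-4 * (‖y‖ ^ 2 + 10) / (2 + ‖y‖ ^ 2) ^ 3) * (2 * ‖v‖ ^ 2) := by
  have e : (fun x => fderiv ℝ Q x v) =
      fun x => (-4 * (‖x‖ ^ 2 + 10) / (2 + ‖x‖ ^ 2) ^ 3) * (2 * innerSL ℝ v x) := by
    funext x
    rw [(hasFDerivAt_Q x).fderiv]
    simp [real_inner_comm]
  have h1 := hasFDerivAt_radial y (hasDerivAt_q2 (‖y‖ ^ 2) (by positivity))
  have h2 := ((innerSL ℝ v).hasFDerivAt (x := y)).const_mul (2 : ℝ)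
  rw [e]
  erw [(h1.mul h2).fderiv]
  simp [real_inner_comm v y]
  ring

/-- `Q` satisfies the self-similar profile equation of the 3D Keller–Segel
equation: `ΔQ + ∇Q·(4y/(2+|y|²)) + Q² = Q + (1/2) y·∇Q`, i.e. `ΔQ + ∇·(Q∇φ) = (1/2)ΛQ`
with `∇φ(y) = 4y/(2+|y|²)` and `Λf = 2f + y·∇f`. -/
theorem stmt1 : ∀ y : R3,
    lap Q y + ⟪gradient Q y, (4 / (2 + ‖y‖ ^ 2)) • y⟫ + Q y ^ 2
      = Q y + (1 / 2) * ⟪y, gradient Q y⟫ := by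
  intro y
  have hg : gradient Q y = (-4 * (‖y‖ ^ 2 + 10) / (2 + ‖y‖ ^ 2) ^ 3) • ((2 : ℝ) • y) := by
    apply HasGradientAt.gradient
    rw [hasGradientAt_iff_hasFDerivAt]
    refine (hasFDerivAt_Q y).congr_fderiv ?_
    ext v
    simp [inner_smul_left]
  have hn : ‖y‖ ^ 2 = y 0 ^ 2 + y 1 ^ 2 + y 2 ^ 2 := by
    simp [EuclideanSpace.norm_sq_eq, Fin.sum_univ_three]
  have hl : lap Q y = (8 * ‖y‖ ^ 2 + 112) / (2 + ‖y‖ ^ 2) ^ 4 * (4 * ‖y‖ ^ 2)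
        + (-4 * (‖y‖ ^ 2 + 10) / (2 + ‖y‖ ^ 2) ^ 3) * 6 := by
    unfold lap
    simp only [second_Q, Fin.sum_univ_three, EuclideanSpace.inner_single_right]
    simp
    rw [hn]
    ring
  rw [hl, hg]
  simp only [inner_smul_left, inner_smul_right, real_inner_self_eq_norm_sq, Q]
  have h0 : 2 + ‖y‖ ^ 2 ≠ 0 := by positivity
  generalize ‖y‖ ^ 2 = s at *
  simp
  field_simp
  ring
end
end

section
/- Fix T > 0. Define ρ : [0,T) × ℝ³ → ℝ by ρ(t,x) = (T−t)⁻¹·Q(x/√(T−t)) where Q(y) = 4(6+|y|²)/(2+|y|²)², and define c : [0,T) × ℝ³ → ℝ by c(t,x) = −2·log(2 + |x|²/(T−t)). Then for every t ∈ [0,T) and x ∈ ℝ³: (i) −Δₓc(t,x) = ρ(t,x); (ii) ∂ₜρ(t,x) = Δₓρ(t,x) − ∇ₓρ(t,x)·∇ₓc(t,x) + ρ(t,x)², i.e. (ρ,c) is a classical solution of the Keller–Segel system ∂ₜρ = Δρ − ∇·(ρ∇c), −Δc = ρ; (iii) the solution blows up at time T in the sense that sup_{x∈ℝ³} ρ(t,x)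 = 6/(T−t), which tends to +∞ as t → T⁻. -/
open MeasureTheory Filter Matrix
open scoped RealInnerProductSpace BigOperators

noncomputable section

/-- The self-similar density `ρ(t,x) = (T−t)⁻¹ Q(x/√(T−t))`. -/
def rho (T t : ℝ) (x : R3) : ℝ := (T - t)⁻¹ * Q ((Real.sqrt (T - t))⁻¹ • x)

/-- The associated chemical concentration `c(t,x) = −2 log(2 + |x|²/(T−t))`. -/
def conc (T t : ℝ) (x : R3) : ℝ := -2 * Real.log (2 + ‖x‖ ^ 2 / (T - t))

theorem radial_hasFDerivAt {g g1 : ℝ → ℝ} (h1 : ∀ r, 0 ≤ r → HasDerivAt g (g1 r) r) (x : R3) :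
    HasFDerivAt (fun y : R3 => g (‖y‖ ^ 2)) ((g1 (‖x‖ ^ 2)) • ((2 : ℝ) • innerSL ℝ x)) x := by
  have h := (h1 (‖x‖ ^ 2) (by positivity)).comp_hasFDerivAt x (hasStrictFDerivAt_norm_sq x).hasFDerivAt
  refine HasFDerivAt.congr_fderiv h ?_
  ext v
  simp

theorem radial_gradient {g g1 : ℝ → ℝ} (h1 : ∀ r, 0 ≤ r → HasDerivAt g (g1 r) r) (x : R3) :
    gradient (fun y : R3 => g (‖y‖ ^ 2)) x = (2 * g1 (‖x‖ ^ 2)) • x := by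
  apply HasGradientAt.gradient
  rw [hasGradientAt_iff_hasFDerivAt]
  refine HasFDerivAt.congr_fderiv (radial_hasFDerivAt h1 x) ?_
  ext v
  simp
  ring

theorem radial_lap {g g1 g2 : ℝ → ℝ} (h1 : ∀ r, 0 ≤ r → HasDerivAt g (g1 r) r)
    (h2 : ∀ r, 0 ≤ r → HasDerivAt g1 (g2 r) r) (x : R3) :
    lap (fun y : R3 => g (‖y‖ ^ 2)) x = 4 * ‖x‖ ^ 2 * g2 (‖x‖ ^ 2) + 6 * g1 (‖x‖ ^ 2) := by
  have key : ∀ i : Fin 3, fderiv ℝ (fun z => fderiv ℝ (fun y : R3 => g (‖y‖ ^ 2)) z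
      (EuclideanSpace.single i 1)) x (EuclideanSpace.single i 1)
      = 4 * g2 (‖x‖ ^ 2) * (x i) ^ 2 + 2 * g1 (‖x‖ ^ 2) := by
    intro i
    have e : (fun z => fderiv ℝ (fun y : R3 => g (‖y‖ ^ 2)) z (EuclideanSpace.single i 1))
        = fun z : R3 => g1 (‖z‖ ^ 2) * (2 * z i) := by
      funext z
      rw [(radial_hasFDerivAt h1 z).fderiv]
      simp [EuclideanSpace.inner_single_right]
    rw [e]
    have hp : HasFDerivAt (fun z : R3 => 2 * z i)
        ((2 : ℝ) • (EuclideanSpace.proj i : R3 →L[ℝ] ℝ)) x := by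
      exact ((EuclideanSpace.proj i : R3 →L[ℝ] ℝ).hasFDerivAt).const_mul 2
    have h := (radial_hasFDerivAt h2 x).mul hp
    erw [h.fderiv]
    simp [EuclideanSpace.inner_single_right]
    ring
  unfold lap
  simp only [key]
  rw [EuclideanSpace.norm_sq_eq]
  simp [Fin.sum_univ_three]
  ring

theorem rho_eq {T t : ℝ} (h : t < T) (x : R3) :
    rho T t x = 4 * (6 * (T - t) + ‖x‖ ^ 2) / (2 * (T - t) + ‖x‖ ^ 2) ^ 2 := by
  have ha : 0 < T - t := sub_pos.2 h
  have e : ‖(Real.sqrt (T - t))⁻¹ • x‖ ^ 2 = ‖x‖ ^ 2 / (T - t) := by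
    rw [norm_smul, mul_pow, norm_inv, inv_pow, Real.norm_eq_abs, sq_abs, Real.sq_sqrt ha.le]
    field_simp
  unfold rho Q
  rw [e]
  generalize T - t = a at *
  have : 0 ≤ ‖x‖ ^ 2 := by positivity
  generalize ‖x‖ ^ 2 = r at *
  have : 2 * a + r ≠ 0 := by positivity
  field_simp

theorem conc_d1 {a : ℝ} (ha : 0 < a) (r : ℝ) (hr : 0 ≤ r) :
    HasDerivAt (fun r => -2 * Real.log (2 + r / a)) (-2 / (2 * a + r)) r := by
  have : 2 * a + r ≠ 0 := by positivity
  have h0 : 2 + r / a ≠ 0 := by positivity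
  have h := ((((hasDerivAt_id r).div_const a).const_add 2).log h0).const_mul (-2)
  refine HasDerivAt.congr_deriv h ?_
  simp only [id]
  field_simp

theorem conc_d2 {a : ℝ} (ha : 0 < a) (r : ℝ) (hr : 0 ≤ r) :
    HasDerivAt (fun r => -2 / (2 * a + r)) (2 / (2 * a + r) ^ 2) r := by
  have h0 : 2 * a + r ≠ 0 := by positivity
  have h := (hasDerivAt_const r (-2 : ℝ)).div ((hasDerivAt_id r).const_add (2 * a)) h0
  refine HasDerivAt.congr_deriv h ?_
  simp

theorem rho_d1 {a : ℝ} (ha : 0 < a) (r : ℝ) (hr : 0 ≤ r) :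
    HasDerivAt (fun r => 4 * (6 * a + r) / (2 * a + r) ^ 2)
      (4 * (-10 * a - r) / (2 * a + r) ^ 3) r := by
  have h0 : 2 * a + r ≠ 0 := by positivity
  have h := (((hasDerivAt_id r).const_add (6 * a)).const_mul 4).div
    (((hasDerivAt_id r).const_add (2 * a)).pow 2) (pow_ne_zero 2 h0)
  refine HasDerivAt.congr_deriv h ?_
  simp
  field_simp
  ring

theorem rho_d2 {a : ℝ} (ha : 0 < a) (r : ℝ) (hr : 0 ≤ r) :
    HasDerivAt (fun r => 4 * (-10 * a - r) / (2 * a + r) ^ 3)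
      (4 * (28 * a + 2 * r) / (2 * a + r) ^ 4) r := by
  have h0 : 2 * a + r ≠ 0 := by positivity
  have h := (((hasDerivAt_id r).const_sub (-10 * a)).const_mul 4).div
    (((hasDerivAt_id r).const_add (2 * a)).pow 3) (pow_ne_zero 3 h0)
  refine HasDerivAt.congr_deriv h ?_
  simp
  field_simp
  ring

theorem rho_dt {T t r : ℝ} (h : t < T) (hr : 0 ≤ r) :
    HasDerivAt (fun s => 4 * (6 * (T - s) + r) / (2 * (T - s) + r) ^ 2)
      (8 * (6 * (T - t) - r) / (2 * (T - t) + r) ^ 3) t := by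
  have ha : 0 < T - t := sub_pos.2 h
  have h0 : 2 * (T - t) + r ≠ 0 := by positivity
  have h := (((((hasDerivAt_id t).const_sub T).const_mul 6).add_const r).const_mul 4).div
    (((((hasDerivAt_id t).const_sub T).const_mul 2).add_const r).pow 2) (pow_ne_zero 2 h0)
  refine HasDerivAt.congr_deriv h ?_
  simp
  field_simp
  ring

/-- for every `T > 0`, `(ρ, c)` is a classical solution on `[0,T) × ℝ³` of the
Keller–Segel system `∂ₜρ = Δρ − ∇ρ·∇c + ρ²`, `−Δc = ρ`, and it blows up at time `T`:
`sup_x ρ(t,x) = 6/(T−t) → +∞` as `t → T⁻`. -/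
theorem stmt2 (T : ℝ) (hT : 0 < T) :
    (∀ t, 0 ≤ t → t < T → ∀ x : R3, -lap (conc T t) x = rho T t x) ∧
    (∀ t, 0 ≤ t → t < T → ∀ x : R3,
      deriv (fun s => rho T s x) t
        = lap (rho T t) x - ⟪gradient (rho T t) x, gradient (conc T t) x⟫ + rho T t x ^ 2) ∧
    (∀ t, 0 ≤ t → t < T → (⨆ x : R3, rho T t x) = 6 / (T - t)) ∧
    Tendsto (fun t => (6 : ℝ) / (T - t)) (nhdsWithin T (Set.Iio T)) atTop := by
  have hrho : ∀ t, t < T → rho T t = fun x : R3 =>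
      (fun r => 4 * (6 * (T - t) + r) / (2 * (T - t) + r) ^ 2) (‖x‖ ^ 2) :=
    fun t h => funext (rho_eq h)
  have hconc : ∀ t, conc T t = fun x : R3 =>
      (fun r => -2 * Real.log (2 + r / (T - t))) (‖x‖ ^ 2) := fun t => rfl
  refine ⟨?_, ?_, ?_, ?_⟩
  · intro t _ h x
    have ha : 0 < T - t := sub_pos.2 h
    rw [hconc, radial_lap (conc_d1 ha) (conc_d2 ha), rho_eq h]
    have : 2 * (T - t) + ‖x‖ ^ 2 ≠ 0 := by positivity
    field_simp
    ring
  · intro t _ h x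
    have ha : 0 < T - t := sub_pos.2 h
    have e : (fun s => rho T s x) =ᶠ[nhds t]
        fun s => 4 * (6 * (T - s) + ‖x‖ ^ 2) / (2 * (T - s) + ‖x‖ ^ 2) ^ 2 := by
      filter_upwards [Iio_mem_nhds h] with s hs using rho_eq hs x
    rw [e.deriv_eq, (rho_dt h (by positivity)).deriv, rho_eq h, hrho t h, hconc,
      radial_lap (rho_d1 ha) (rho_d2 ha), radial_gradient (rho_d1 ha),
      radial_gradient (conc_d1 ha), real_inner_smul_left, real_inner_smul_right,
      real_inner_self_eq_norm_sq]
    have : 2 * (T - t) + ‖x‖ ^ 2 ≠ 0 := by positivity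
    field_simp
    ring
  · intro t _ h
    have ha : 0 < T - t := sub_pos.2 h
    apply IsLUB.ciSup_eq
    apply IsGreatest.isLUB
    constructor
    · refine ⟨0, ?_⟩
      simp only [rho_eq h]
      simp
      field_simp
      norm_num
    · rintro _ ⟨x, rfl⟩
      simp only [rho_eq h]
      have hr : 0 ≤ ‖x‖ ^ 2 := by positivity
      generalize ‖x‖ ^ 2 = r at *
      generalize T - t = a at *
      rw [div_le_div_iff₀ (by positivity) ha]
      nlinarith [mul_nonneg ha.le hr, sq_nonneg r]
  · have h : Tendsto (fun t => T - t) (nhdsWithin T (Set.Iio T)) (nhdsWithin 0 (Set.Ioi 0)) := by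
      rw [tendsto_nhdsWithin_iff]
      constructor
      · have : Tendsto (fun t => T - t) (nhds T) (nhds (T - T)) := by
          exact (continuous_const.sub continuous_id).tendsto T
        rw [sub_self] at this
        exact this.mono_left nhdsWithin_le_nhds
      · filter_upwards [self_mem_nhdsWithin] with t ht using sub_pos.2 (Set.mem_Iio.1 ht)
    simp only [div_eq_mul_inv]
    exact (h.inv_tendsto_nhdsGT_zero).const_mul_atTop (by norm_num)
end
end

section
/- Let f : ℝ³ → ℝ be a Schwartz function. For s > 0 let G_s(x) = (4πs)^{−3/2}·e^{−|x|²/(4s)} be the heat kernel on ℝ³, and define v : (0,∞) × ℝ³ → ℝ by v(τ,y) = e^{−τ}·∫_{ℝ³} G_{1−e^{−τ}}(e^{−τ/2}y − z)·f(z) dz. Then: (i) for every τ > 0 and y ∈ ℝ³, ∂_τ v(τ,y) = Δ_y v(τ,y) − v(τ,y) − (1/2)·y·∇_y v(τ,y), i.e. v solves ∂_τ v + L₀v = 0 with L₀v = −Δv + v + (1/2)y·∇v; (ii) for every y ∈ ℝ³, v(τ,y) → f(y) as τ → 0⁺. In other words, v(τ,·) = e^{−τL₀}f is the explicit semigroup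 generated by −L₀, obtained by self-similar renormalization of the heat flow. -/
open MeasureTheory Filter Matrix
open scoped RealInnerProductSpace BigOperators

noncomputable section

/-- The heat kernel `G_s(x) = (4πs)^{−3/2} e^{−|x|²/(4s)}` on `ℝ³`. -/
def heatK (s : ℝ) (x : R3) : ℝ :=
  (4 * Real.pi * s) ^ (-(3 : ℝ) / 2) * Real.exp (-‖x‖ ^ 2 / (4 * s))

/-- The self-similar renormalization of the heat flow of `f`:
`v(τ,y) = e^{−τ} (G_{1−e^{−τ}} * f)(e^{−τ/2} y)`. -/
def vFlow (f : SchwartzMap R3 ℝ) (τ : ℝ) (y : R3) : ℝ :=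
  Real.exp (-τ) *
    ∫ z : R3, heatK (1 - Real.exp (-τ)) (Real.exp (-τ / 2) • y - z) * f z

/-- The Gaussian `G_1`. -/
def Gd (w : R3) : ℝ := (4 * Real.pi) ^ (-(3 : ℝ) / 2) * Real.exp (-(1 / 4) * ‖w‖ ^ 2)

lemma Gd_nonneg (w : R3) : 0 ≤ Gd w := by unfold Gd; positivity

lemma Gd_cont : Continuous Gd := by unfold Gd; fun_prop

lemma integrable_gauss {b : ℝ} (hb : 0 < b) :
    Integrable (fun w : R3 => Real.exp (-b * ‖w‖ ^ 2)) := by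
  by_contra h
  have h1 := GaussianFourier.integral_rexp_neg_mul_sq_norm (V := R3) hb
  rw [integral_undef h] at h1
  have : 0 < (Real.pi / b) ^ (Module.finrank ℝ R3 / 2 : ℝ) := by positivity
  linarith

lemma Gd_int : Integrable Gd := (integrable_gauss (by norm_num)).const_mul _

lemma Gd_integral : ∫ w, Gd w = 1 := by
  unfold Gd
  rw [integral_const_mul, GaussianFourier.integral_rexp_neg_mul_sq_norm (by norm_num)]
  have : Real.pi / (1 / 4) = 4 * Real.pi := by ring
  rw [this, ← Real.rpow_add (by positivity)]
  simp
  norm_num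

lemma Gd_norm_int : Integrable (fun w => Gd w * ‖w‖) := by
  refine Integrable.mono' (((integrable_gauss (b := 1 / 8) (by norm_num)).const_mul
    ((4 * Real.pi) ^ (-(3 : ℝ) / 2) * 2))) ?_ ?_
  · exact (Gd_cont.mul continuous_norm).aestronglyMeasurable
  · refine ae_of_all _ fun w => ?_
    rw [Real.norm_of_nonneg (mul_nonneg (Gd_nonneg w) (norm_nonneg w))]
    unfold Gd
    have h1 : ‖w‖ ≤ 2 * Real.exp (1 / 8 * ‖w‖ ^ 2) := by
      have := Real.add_one_le_exp (1 / 8 * ‖w‖ ^ 2)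
      nlinarith [sq_nonneg (‖w‖ - 2)]
    have h2 : Real.exp (-(1 / 8) * ‖w‖ ^ 2) =
        Real.exp (-(1 / 4) * ‖w‖ ^ 2) * Real.exp (1 / 8 * ‖w‖ ^ 2) := by
      rw [← Real.exp_add]; ring_nf
    rw [h2]
    have h3 : 0 ≤ (4 * Real.pi) ^ (-(3 : ℝ) / 2) * Real.exp (-(1 / 4) * ‖w‖ ^ 2) := by positivity
    nlinarith [mul_le_mul_of_nonneg_left h1 h3]

lemma Gd_hasFDerivAt (w : R3) :
    HasFDerivAt Gd ((-(1 / 2) * Gd w) • innerSL ℝ w) w := by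
  unfold Gd
  have h := (((hasStrictFDerivAt_norm_sq w).hasFDerivAt.const_mul (-(1 / 4) : ℝ)).exp).const_mul
    ((4 * Real.pi) ^ (-(3 : ℝ) / 2))
  refine h.congr_fderiv ?_
  ext v
  simp
  ring

/-- The change of variables. -/
lemma heat_eq (f : SchwartzMap R3 ℝ) {b : ℝ} (hb : 0 < b) (x : R3) :
    ∫ z : R3, heatK (b ^ 2) (x - z) * f z = ∫ w, Gd w * f (x - b • w) := by
  have h1 := integral_sub_left_eq_self (fun z => heatK (b ^ 2) z * f (x - z)) (volume : Measure R3) x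
  simp only [sub_sub_cancel] at h1
  rw [h1]
  have h2 := Measure.integral_comp_smul (volume : Measure R3)
    (fun z => heatK (b ^ 2) z * f (x - z)) b
  have h3 : ∀ w, Gd w * f (x - b • w) = b ^ 3 * (heatK (b ^ 2) (b • w) * f (x - b • w)) := by
    intro w
    unfold Gd heatK
    rw [Real.mul_rpow (x := 4 * Real.pi) (y := b ^ 2) (by positivity) (by positivity)]
    have : (b ^ 2) ^ (-(3 : ℝ) / 2) = (b ^ 3)⁻¹ := by
      rw [← Real.rpow_natCast b 2, ← Real.rpow_mul hb.le, ← Real.rpow_natCast b 3,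
        ← Real.rpow_neg hb.le]
      norm_num
    rw [this, norm_smul, Real.norm_of_nonneg hb.le]
    have e : -(b * ‖w‖) ^ 2 / (4 * b ^ 2) = -(1 / 4) * ‖w‖ ^ 2 := by field_simp
    rw [e]
    field_simp
  simp_rw [h3]
  rw [integral_const_mul, h2]
  simp
  rw [abs_of_pos hb]
  field_simp

lemma schwartz_bdd {E : Type*} [NormedAddCommGroup E] [NormedSpace ℝ E] (f : SchwartzMap R3 E) :
    ∃ C, 0 ≤ C ∧ ∀ x, ‖f x‖ ≤ C :=
  ⟨_, (norm_nonneg _).trans (f.norm_le_seminorm ℝ 0), f.norm_le_seminorm ℝ⟩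

lemma schwartz_fderiv_bdd (f : SchwartzMap R3 ℝ) :
    ∃ C, 0 ≤ C ∧ ∀ x, ‖fderiv ℝ f x‖ ≤ C :=
  schwartz_bdd (SchwartzMap.fderivCLM ℝ R3 ℝ f)

lemma schwartz_fderiv_cont (f : SchwartzMap R3 ℝ) : Continuous (fderiv ℝ f) :=
  (SchwartzMap.fderivCLM ℝ R3 ℝ f).continuous

/-- The averaged function. -/
def Av (f : SchwartzMap R3 ℝ) (a b : ℝ) (y : R3) : ℝ := ∫ w, Gd w * f (a • y - b • w)

lemma Gd_mul_int {h : R3 → ℝ} (hc : Continuous h) {C : ℝ} (hC : ∀ x, ‖h x‖ ≤ C) :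
    Integrable (fun w => Gd w * h w) := by
  refine Integrable.mono' (Gd_int.mul_const C) (Gd_cont.mul hc).aestronglyMeasurable
    (ae_of_all _ fun w => ?_)
  rw [norm_mul, Real.norm_of_nonneg (Gd_nonneg w)]
  exact mul_le_mul_of_nonneg_left (hC w) (Gd_nonneg w)

lemma Av_int (f : SchwartzMap R3 ℝ) (a b : ℝ) (y : R3) :
    Integrable (fun w => Gd w * f (a • y - b • w)) := by
  obtain ⟨C, _, hC⟩ := schwartz_bdd f
  exact Gd_mul_int (h := fun w => f (a • y - b • w)) (by have := f.continuous; fun_prop)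
    (fun x => hC _)

lemma Av_hasFDerivAt (f : SchwartzMap R3 ℝ) (a b : ℝ) (y : R3) :
    Integrable (fun w => (Gd w * a) • fderiv ℝ f (a • y - b • w)) ∧
    HasFDerivAt (Av f a b) (∫ w, (Gd w * a) • fderiv ℝ f (a • y - b • w)) y := by
  obtain ⟨C, hC0, hC⟩ := schwartz_fderiv_bdd f
  have hm : AEStronglyMeasurable (fun w => (Gd w * a) • fderiv ℝ f (a • y - b • w)) volume := by
    have := schwartz_fderiv_cont f
    have := Gd_cont
    exact Continuous.aestronglyMeasurable (by fun_prop)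
  have hb : ∀ w y, ‖(Gd w * a) • fderiv ℝ f (a • y - b • w)‖ ≤ Gd w * (|a| * C) := by
    intro w y
    rw [norm_smul, norm_mul, Real.norm_of_nonneg (Gd_nonneg w), Real.norm_eq_abs, mul_assoc]
    have := Gd_nonneg w
    gcongr
    exact hC _
  refine ⟨Integrable.mono' (Gd_int.mul_const (|a| * C)) hm (ae_of_all _ fun w => hb w y), ?_⟩
  refine hasFDerivAt_integral_of_dominated_of_fderiv_le (s := Set.univ)
    (F := fun y w => Gd w * f (a • y - b • w))
    (F' := fun y w => (Gd w * a) • fderiv ℝ f (a • y - b • w))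
    (bound := fun w => Gd w * (|a| * C)) Filter.univ_mem
    (Eventually.of_forall fun y => (Av_int f a b y).aestronglyMeasurable) (Av_int f a b y)
    hm (ae_of_all _ fun w y _ => hb w y) (Gd_int.mul_const _) (ae_of_all _ fun w y _ => ?_)
  have h1 : HasFDerivAt (fun y : R3 => a • y - b • w) (a • ContinuousLinearMap.id ℝ R3) y :=
    ((hasFDerivAt_id y).const_smul a).sub_const _
  have h2 := ((f.hasFDerivAt (a • y - b • w)).comp y h1).const_mul (Gd w)
  refine h2.congr_fderiv ?_
  ext v
  simp
  ring

open LineDeriv in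
lemma Av_fderiv (f : SchwartzMap R3 ℝ) (a b : ℝ) (y v : R3) :
    fderiv ℝ (Av f a b) y v = a * Av (∂_{v} f) a b y := by
  obtain ⟨hi, hd⟩ := Av_hasFDerivAt f a b y
  rw [hd.fderiv, ContinuousLinearMap.integral_apply hi]
  unfold Av
  rw [← integral_const_mul]
  congr 1
  ext w
  simp [SchwartzMap.lineDerivOp_apply_eq_fderiv]
  ring

lemma Av_diff (f : SchwartzMap R3 ℝ) (a b : ℝ) : Differentiable ℝ (Av f a b) :=
  fun y => (Av_hasFDerivAt f a b y).2.differentiableAt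

open LineDeriv in
/-- Integration by parts. -/
lemma Av_ibp (f : SchwartzMap R3 ℝ) (a b : ℝ) (y v : R3) :
    ∫ w, Gd w * (inner ℝ w v * f (a • y - b • w)) = -(2 * b) * Av (∂_{v} f) a b y := by
  have hG : ∀ w, fderiv ℝ Gd w v = -(1 / 2) * Gd w * inner ℝ w v := by
    intro w; rw [(Gd_hasFDerivAt w).fderiv]; simp
  have hF : ∀ w, HasFDerivAt (fun w => f (a • y - b • w))
      ((-b) • fderiv ℝ f (a • y - b • w)) w := by
    intro w
    have h1 : HasFDerivAt (fun w : R3 => a • y - b • w) (-(b • ContinuousLinearMap.id ℝ R3)) w :=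
      ((hasFDerivAt_id w).const_smul b).const_sub _
    refine ((f.hasFDerivAt (a • y - b • w)).comp w h1).congr_fderiv ?_
    ext v
    simp
  have hF' : ∀ w, fderiv ℝ (fun w => f (a • y - b • w)) w v = -b * (∂_{v} f) (a • y - b • w) := by
    intro w; rw [(hF w).fderiv]; simp [SchwartzMap.lineDerivOp_apply_eq_fderiv]
  obtain ⟨C, hC0, hC⟩ := schwartz_bdd f
  have key := integral_mul_fderiv_eq_neg_fderiv_mul_of_integrable (μ := (volume : Measure R3))
    (f := Gd) (g := fun w => f (a • y - b • w)) (v := v) ?_ ?_ (Av_int f a b y)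
    (fun w _ => (Gd_hasFDerivAt w).differentiableAt) (fun w _ => (hF w).differentiableAt)
  · simp_rw [hG, hF'] at key
    have e1 : ∫ w, Gd w * (-b * (∂_{v} f) (a • y - b • w)) = -b * Av (∂_{v} f) a b y := by
      unfold Av; rw [← integral_const_mul]; congr 1; ext w; ring
    have e2 : ∫ w, -(1 / 2) * Gd w * inner ℝ w v * f (a • y - b • w)
        = -(1 / 2) * ∫ w, Gd w * (inner ℝ w v * f (a • y - b • w)) := by
      rw [← integral_const_mul]; congr 1; ext w; ring
    rw [e1, e2] at key
    linarith
  · simp_rw [hG]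
    refine Integrable.mono' (Gd_norm_int.mul_const (‖v‖ * C)) ?_ (ae_of_all _ fun w => ?_)
    · have := Gd_cont
      have := f.continuous
      exact Continuous.aestronglyMeasurable (by fun_prop)
    · rw [norm_mul, norm_mul, norm_mul, Real.norm_of_nonneg (Gd_nonneg w)]
      have h1 := norm_inner_le_norm (𝕜 := ℝ) w v
      have h2 : ‖(-(1 / 2) : ℝ)‖ ≤ 1 := by norm_num
      have := Gd_nonneg w
      calc _ ≤ 1 * Gd w * (‖w‖ * ‖v‖) * C := by gcongr; exact hC _
        _ = _ := by ring
  · simp_rw [hF']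
    refine ((Av_int (∂_{v} f) a b y).const_mul (-b)).congr (ae_of_all _ fun w => ?_)
    simp only
    ring

lemma one_sub_pos {τ : ℝ} (h : 0 < τ) : 0 < 1 - Real.exp (-τ) := by
  have : Real.exp (-τ) < 1 := by
    rw [← Real.exp_zero]; exact Real.exp_lt_exp.2 (by linarith)
  linarith

lemma vFlow_eq (f : SchwartzMap R3 ℝ) {τ : ℝ} (hτ : 0 < τ) (y : R3) :
    vFlow f τ y = Real.exp (-τ) * Av f (Real.exp (-τ / 2)) (√(1 - Real.exp (-τ))) y := by
  unfold vFlow Av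
  have := heat_eq f (Real.sqrt_pos.2 (one_sub_pos hτ)) (Real.exp (-τ / 2) • y)
  rw [Real.sq_sqrt (one_sub_pos hτ).le] at this
  rw [this]

lemma Av_hasDerivAt (f : SchwartzMap R3 ℝ) {τ : ℝ} (hτ : 0 < τ) (y : R3) :
    Integrable (fun w => Gd w * fderiv ℝ f (Real.exp (-τ / 2) • y - √(1 - Real.exp (-τ)) • w)
        ((-(1 / 2) * Real.exp (-τ / 2)) • y -
          (Real.exp (-τ) / (2 * √(1 - Real.exp (-τ)))) • w)) ∧
    HasDerivAt (fun σ => Av f (Real.exp (-σ / 2)) (√(1 - Real.exp (-σ))) y)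
      (∫ w, Gd w * fderiv ℝ f (Real.exp (-τ / 2) • y - √(1 - Real.exp (-τ)) • w)
        ((-(1 / 2) * Real.exp (-τ / 2)) • y -
          (Real.exp (-τ) / (2 * √(1 - Real.exp (-τ)))) • w)) τ := by
  obtain ⟨C, hC0, hC⟩ := schwartz_fderiv_bdd f
  have hk := one_sub_pos (half_pos hτ)
  have hk' := Real.sqrt_pos.2 hk
  refine hasDerivAt_integral_of_dominated_loc_of_deriv_le (s := Set.Ioi (τ / 2))
    (F := fun σ w => Gd w * f (Real.exp (-σ / 2) • y - √(1 - Real.exp (-σ)) • w))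
    (F' := fun σ w => Gd w * fderiv ℝ f (Real.exp (-σ / 2) • y - √(1 - Real.exp (-σ)) • w)
        ((-(1 / 2) * Real.exp (-σ / 2)) • y -
          (Real.exp (-σ) / (2 * √(1 - Real.exp (-σ)))) • w))
    (bound := fun w => Gd w * (C * ‖y‖) + Gd w * ‖w‖ * (C * (1 / (2 * √(1 - Real.exp (-(τ / 2)))))))
    (Ioi_mem_nhds (by linarith))
    (Eventually.of_forall fun σ => (Av_int f _ _ y).aestronglyMeasurable) (Av_int f _ _ y)
    ?_ (ae_of_all _ fun w σ hσ => ?_)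
    ((Gd_int.mul_const _).add (Gd_norm_int.mul_const _)) (ae_of_all _ fun w σ hσ => ?_)
  · have := schwartz_fderiv_cont f
    have := Gd_cont
    exact Continuous.aestronglyMeasurable (by fun_prop)
  · have hσ' : τ / 2 < σ := hσ
    have hσ0 : 0 < σ := by linarith
    rw [norm_mul, Real.norm_of_nonneg (Gd_nonneg w), mul_assoc, ← mul_add]
    refine mul_le_mul_of_nonneg_left ?_ (Gd_nonneg w)
    refine (ContinuousLinearMap.le_opNorm _ _).trans ?_
    have h1 : ‖(-(1 / 2) * Real.exp (-σ / 2)) • y‖ ≤ ‖y‖ := by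
      rw [norm_smul, norm_mul, Real.norm_of_nonneg (Real.exp_pos _).le]
      have : Real.exp (-σ / 2) ≤ 1 := Real.exp_le_one_iff.2 (by linarith)
      have h2 : ‖(-(1 / 2) : ℝ)‖ ≤ 1 := by norm_num
      calc _ ≤ 1 * 1 * ‖y‖ := by gcongr
        _ = _ := by ring
    have h2 : ‖(Real.exp (-σ) / (2 * √(1 - Real.exp (-σ)))) • w‖ ≤
        (1 / (2 * √(1 - Real.exp (-(τ / 2))))) * ‖w‖ := by
      rw [norm_smul, Real.norm_of_nonneg (by positivity)]
      have : Real.exp (-σ) ≤ 1 := Real.exp_le_one_iff.2 (by linarith)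
      gcongr
    calc _ ≤ C * (‖y‖ + (1 / (2 * √(1 - Real.exp (-(τ / 2))))) * ‖w‖) := by
          gcongr
          · exact hC _
          · exact (norm_sub_le _ _).trans (add_le_add h1 h2)
      _ = _ := by ring
  · have hσ' : τ / 2 < σ := hσ
    have hσ0 : 0 < σ := by linarith
    have e1 : HasDerivAt (fun σ : ℝ => Real.exp (-σ / 2)) (-(1 / 2) * Real.exp (-σ / 2)) σ := by
      have := ((hasDerivAt_id σ).neg.div_const 2).exp
      refine this.congr_deriv ?_
      simp
      ring
    have e2 : HasDerivAt (fun σ : ℝ => √(1 - Real.exp (-σ)))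
        (Real.exp (-σ) / (2 * √(1 - Real.exp (-σ)))) σ := by
      have := (((hasDerivAt_id σ).neg.exp).const_sub 1).sqrt (one_sub_pos hσ0).ne'
      refine this.congr_deriv ?_
      simp
    have e3 := (e1.smul_const y).sub (e2.smul_const w)
    exact ((f.hasFDerivAt _).comp_hasDerivAt σ e3).const_mul (Gd w)

open LineDeriv in
lemma schwartz_fderiv_sum (f : SchwartzMap R3 ℝ) (x w : R3) :
    fderiv ℝ f x w = ∑ i : Fin 3, inner ℝ w (EuclideanSpace.single i (1 : ℝ)) *
      (∂_{(EuclideanSpace.single i (1 : ℝ) : R3)} f) x := by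
  have h : w = ∑ i : Fin 3, (inner ℝ w (EuclideanSpace.single i (1 : ℝ))) •
      (EuclideanSpace.single i (1 : ℝ) : R3) := by
    ext j
    fin_cases j <;> simp [Fin.sum_univ_three, real_inner_comm _ w, EuclideanSpace.inner_single_left, EuclideanSpace.inner_single_right]
  conv_lhs => rw [h]
  rw [map_sum]
  simp [SchwartzMap.lineDerivOp_apply_eq_fderiv]

lemma inner_int (f : SchwartzMap R3 ℝ) (a b : ℝ) (y v : R3) :
    Integrable (fun w => Gd w * (inner ℝ w v * f (a • y - b • w))) := by
  obtain ⟨C, hC0, hC⟩ := schwartz_bdd f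
  refine Integrable.mono' (Gd_norm_int.mul_const (‖v‖ * C)) ?_ (ae_of_all _ fun w => ?_)
  · have := Gd_cont
    have := f.continuous
    exact Continuous.aestronglyMeasurable (by fun_prop)
  · rw [norm_mul, norm_mul, Real.norm_of_nonneg (Gd_nonneg w)]
    have h1 := norm_inner_le_norm (𝕜 := ℝ) w v
    have := Gd_nonneg w
    calc _ ≤ Gd w * ((‖w‖ * ‖v‖) * C) := by gcongr; exact hC _
      _ = _ := by ring

open LineDeriv in
lemma int_split (f : SchwartzMap R3 ℝ) (a b p q : ℝ) (y : R3) :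
    ∫ w, Gd w * fderiv ℝ f (a • y - b • w) (p • y - q • w)
      = p * Av (∂_{y} f) a b y + (2 * b * q) *
        ∑ i : Fin 3, Av (∂_{(EuclideanSpace.single i (1 : ℝ) : R3)}
          (∂_{(EuclideanSpace.single i (1 : ℝ) : R3)} f)) a b y := by
  have e : ∀ w, Gd w * fderiv ℝ f (a • y - b • w) (p • y - q • w) =
      p * (Gd w * (∂_{y} f) (a • y - b • w)) - q * ∑ i : Fin 3, Gd w *
        (inner ℝ w (EuclideanSpace.single i (1 : ℝ)) *
          (∂_{(EuclideanSpace.single i (1 : ℝ) : R3)} f) (a • y - b • w)) := by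
    intro w
    rw [map_sub, map_smul, map_smul, schwartz_fderiv_sum f _ w, ← Finset.mul_sum,
      SchwartzMap.lineDerivOp_apply_eq_fderiv]
    simp only [smul_eq_mul]
    ring
  simp_rw [e]
  rw [integral_sub ((Av_int _ a b y).const_mul _)
    ((integrable_finsetSum _ fun i _ => inner_int _ a b y _).const_mul _),
    integral_const_mul, integral_const_mul, integral_finsetSum _ fun i _ => inner_int _ a b y _]
  simp_rw [Av_ibp]
  rw [← Finset.mul_sum]
  unfold Av
  ring

open LineDeriv in
lemma lap_Av (f : SchwartzMap R3 ℝ) (c a b : ℝ) (y : R3) :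
    lap (fun y => c * Av f a b y) y = c * a ^ 2 *
        ∑ i : Fin 3, Av (∂_{(EuclideanSpace.single i (1 : ℝ) : R3)}
          (∂_{(EuclideanSpace.single i (1 : ℝ) : R3)} f)) a b y := by
  have h : ∀ (c : ℝ) (g : SchwartzMap R3 ℝ) (x v : R3),
      fderiv ℝ (fun y => c * Av g a b y) x v = (c * a) * Av (∂_{v} g) a b x := by
    intro c g x v
    rw [fderiv_const_mul (Av_diff g a b x)]
    simp [Av_fderiv]
    ring
  unfold lap
  simp_rw [h]
  rw [← Finset.mul_sum]
  ring

lemma flow_eq (f : SchwartzMap R3 ℝ) {τ : ℝ} (hτ : 0 < τ) (y : R3) :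
    deriv (fun σ => vFlow f σ y) τ
        = lap (vFlow f τ) y - vFlow f τ y - (1 / 2) * fderiv ℝ (vFlow f τ) y y := by
  have h1 : (fun σ => vFlow f σ y) =ᶠ[nhds τ]
      fun σ => Real.exp (-σ) * Av f (Real.exp (-σ / 2)) (√(1 - Real.exp (-σ))) y := by
    filter_upwards [Ioi_mem_nhds hτ] with σ hσ
    exact vFlow_eq f hσ y
  have h2 : vFlow f τ =
      fun y => Real.exp (-τ) * Av f (Real.exp (-τ / 2)) (√(1 - Real.exp (-τ))) y :=
    funext fun y => vFlow_eq f hτ y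
  have h3 : HasDerivAt (fun σ : ℝ => Real.exp (-σ)) (-Real.exp (-τ)) τ := by
    simpa using (hasDerivAt_id τ).neg.exp
  have h4 : HasDerivAt
      (fun σ => Real.exp (-σ) * Av f (Real.exp (-σ / 2)) (√(1 - Real.exp (-σ))) y) _ τ :=
    h3.mul (Av_hasDerivAt f hτ y).2
  rw [h1.deriv_eq, h2, lap_Av, h4.deriv, int_split,
    fderiv_const_mul (Av_diff f _ _ y)]
  have hb := Real.sqrt_pos.2 (one_sub_pos hτ)
  have ha : Real.exp (-τ / 2) ^ 2 = Real.exp (-τ) := by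
    rw [← Real.exp_nat_mul]; congr 1; push_cast; ring
  have hq : 2 * √(1 - Real.exp (-τ)) * (Real.exp (-τ) / (2 * √(1 - Real.exp (-τ))))
      = Real.exp (-τ) := by field_simp
  rw [hq, ha]
  simp only [_root_.smul_apply, smul_eq_mul, Av_fderiv]
  ring

lemma flow_tendsto (f : SchwartzMap R3 ℝ) (y : R3) :
    Tendsto (fun τ => vFlow f τ y) (nhdsWithin 0 (Set.Ioi 0)) (nhds (f y)) := by
  have h1 : (fun τ => Real.exp (-τ) * Av f (Real.exp (-τ / 2)) (√(1 - Real.exp (-τ))) y)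
      =ᶠ[nhdsWithin 0 (Set.Ioi 0)] (fun τ => vFlow f τ y) := by
    filter_upwards [self_mem_nhdsWithin] with σ hσ
    exact (vFlow_eq f hσ y).symm
  refine Tendsto.congr' h1 ?_
  have hA : Tendsto (fun τ => Av f (Real.exp (-τ / 2)) (√(1 - Real.exp (-τ))) y)
      (nhdsWithin 0 (Set.Ioi 0)) (nhds (∫ w, Gd w * f y)) := by
    obtain ⟨C, hC0, hC⟩ := schwartz_bdd f
    refine tendsto_integral_filter_of_dominated_convergence (fun w => Gd w * C)
      (Eventually.of_forall fun σ => (Av_int f _ _ y).aestronglyMeasurable)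
      (Eventually.of_forall fun σ => ae_of_all _ fun w => ?_) (Gd_int.mul_const C)
      (ae_of_all _ fun w => ?_)
    · rw [norm_mul, Real.norm_of_nonneg (Gd_nonneg w)]
      exact mul_le_mul_of_nonneg_left (hC _) (Gd_nonneg w)
    · have hf := f.continuous
      have : Continuous (fun τ : ℝ =>
          Gd w * f (Real.exp (-τ / 2) • y - √(1 - Real.exp (-τ)) • w)) := by fun_prop
      have := this.tendsto 0
      simp at this
      exact this.mono_left nhdsWithin_le_nhds
  rw [integral_mul_const, Gd_integral, one_mul] at hA
  have hE : Tendsto (fun τ : ℝ => Real.exp (-τ)) (nhdsWithin 0 (Set.Ioi 0)) (nhds 1) := by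
    have : Continuous (fun τ : ℝ => Real.exp (-τ)) := by fun_prop
    have := this.tendsto 0
    simp at this
    exact this.mono_left nhdsWithin_le_nhds
  simpa using hE.mul hA

/-- for a Schwartz function `f`, the function
`v(τ,y) = e^{−τ} ∫ G_{1−e^{−τ}}(e^{−τ/2}y − z) f(z) dz` solves `∂_τ v + L₀ v = 0`
(with `L₀v = −Δv + v + (1/2) y·∇v`) for `τ > 0`, and `v(τ,y) → f(y)` as `τ → 0⁺`;
i.e. `v(τ,·) = e^{−τL₀}f` is the semigroup generated by `−L₀`. -/
theorem stmt5 (f : SchwartzMap R3 ℝ) :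
    (∀ τ : ℝ, 0 < τ → ∀ y : R3,
      deriv (fun σ => vFlow f σ y) τ
        = lap (vFlow f τ) y - vFlow f τ y - (1 / 2) * fderiv ℝ (vFlow f τ) y y) ∧
    (∀ y : R3,
      Tendsto (fun τ => vFlow f τ y) (nhdsWithin 0 (Set.Ioi 0)) (nhds (f y))) := by
  exact ⟨fun τ hτ y => flow_eq f hτ y, flow_tendsto f⟩
end
end

section
/- Let f : ℝ³ → ℝ be a Schwartz function, let Λf(y) = 2f(y) + y·∇f(y), and let k ∈ ℕ. Then ∫_{ℝ³} ⟨ D^k(Λf)(y), D^k f(y) ⟩ dy = ((2k+1)/2) · ∫_{ℝ³} ‖D^k f(y)‖² dy, where D^k denotes the k-th iterated Fréchet derivative and ⟨·,·⟩, ‖·‖ are the natural inner product and norm on k-multilinear maps. In particular, for k = 0 this reads ∫ (2f + y·∇f)·f dy = (1/2)∫ f² dy. -/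
open MeasureTheory Filter Matrix
open scoped RealInnerProductSpace BigOperators

noncomputable section

/-- The natural inner product `⟨D^k f(y), D^k g(y)⟩` of the `k`-th derivatives, computed
via the orthonormal coordinate directions of `ℝ³`. -/
def Dinner (k : ℕ) (f g : R3 → ℝ) (y : R3) : ℝ :=
  ∑ m : Fin k → Fin 3,
    (iteratedFDeriv ℝ k f y fun j => EuclideanSpace.single (m j) 1) *
      (iteratedFDeriv ℝ k g y fun j => EuclideanSpace.single (m j) 1)

/-- The scaling operator `Λf(y) = 2f(y) + y·∇f(y)`. -/
def scalingOp (f : R3 → ℝ) (y : R3) : ℝ := 2 * f y + fderiv ℝ f y y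

/-- multiplication by the `i`-th coordinate -/
def Xm (i : Fin 3) (g : SchwartzMap R3 ℝ) : SchwartzMap R3 ℝ :=
  SchwartzMap.smulLeftCLM ℝ (fun y : R3 => y i) g

theorem coord_tg (i : Fin 3) : Function.HasTemperateGrowth (fun y : R3 => y i) :=
  (EuclideanSpace.proj i : R3 →L[ℝ] ℝ).hasTemperateGrowth

theorem Xm_apply (i : Fin 3) (g : SchwartzMap R3 ℝ) (y : R3) : Xm i g y = y i * g y := by
  simp [Xm, SchwartzMap.smulLeftCLM_apply_apply (coord_tg i)]

/-- coordinate direction -/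
def ee (i : Fin 3) : R3 := EuclideanSpace.single i 1

open LineDeriv

theorem d_Xm (i : Fin 3) (v : R3) (g : SchwartzMap R3 ℝ) :
    ∂_{v} (Xm i g) = Xm i (∂_{v} g) + v i • g := by
  ext y
  have h1 : HasFDerivAt (fun y : R3 => y i)
      (EuclideanSpace.proj i : R3 →L[ℝ] ℝ) y :=
    (EuclideanSpace.proj i : R3 →L[ℝ] ℝ).hasFDerivAt
  have h2 := h1.mul (g.hasFDerivAt y)
  have h3 : (⇑(Xm i g)) = (fun y : R3 => y i) * ⇑g := funext (Xm_apply i g)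
  rw [SchwartzMap.lineDerivOp_apply_eq_fderiv, h3, HasFDerivAt.fderiv h2]
  simp [Xm_apply, SchwartzMap.lineDerivOp_apply_eq_fderiv, mul_comm]

theorem d_comm (v w : R3) (g : SchwartzMap R3 ℝ) :
    ∂_{v} (∂_{w} g) = ∂_{w} (∂_{v} g) := by
  ext y
  have hs : IsSymmSndFDerivAt ℝ (⇑g) y :=
    ((g.smooth 2).contDiffAt).isSymmSndFDerivAt (by simp)
  have hd : DifferentiableAt ℝ (fderiv ℝ (⇑g)) y :=
    (SchwartzMap.fderivCLM ℝ R3 ℝ g).differentiableAt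
  have key : ∀ a b : R3, (∂_{a} (∂_{b} g)) y = fderiv ℝ (fderiv ℝ (⇑g)) y a b := by
    intro a b
    rw [SchwartzMap.lineDerivOp_apply_eq_fderiv]
    have : (⇑(∂_{b} g : SchwartzMap R3 ℝ)) = fun x => fderiv ℝ (⇑g) x b := rfl
    rw [this, fderiv_clm_apply hd (differentiableAt_const b)]
    simp
  rw [key, key]
  exact hs v w

/-- The scaling operator on Schwartz space -/
def Lam (g : SchwartzMap R3 ℝ) : SchwartzMap R3 ℝ := (2 : ℝ) • g + ∑ i, Xm i (∂_{ee i} g)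

theorem sum_ee (y : R3) : ∑ i, y i • ee i = y := by
  ext j
  fin_cases j <;> simp [ee, Fin.sum_univ_three]

theorem Lam_apply (g : SchwartzMap R3 ℝ) : (⇑(Lam g)) = scalingOp (fun x => g x) := by
  ext y
  have h : fderiv ℝ (fun x => g x) y y = ∑ i, y i * fderiv ℝ (⇑g) y (ee i) := by
    conv_lhs => arg 2; rw [← sum_ee y]
    simp [map_sum]
  rw [scalingOp, h]
  simp [Lam, Fin.sum_univ_three, Xm_apply, SchwartzMap.lineDerivOp_apply_eq_fderiv]

theorem d_Lam (v : R3) (g : SchwartzMap R3 ℝ) : ∂_{v} (Lam g) = Lam (∂_{v} g) + ∂_{v} g := by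
  have h : ∂_{v} g = ∑ i, v i • ∂_{ee i} g := by
    conv_lhs => rw [← sum_ee v]
    simp [Fin.sum_univ_three, lineDerivOp_left_add, lineDerivOp_left_smul]
  conv_rhs => rw [h, ← h]
  simp only [Lam, lineDerivOp_add, lineDerivOp_smul, Fin.sum_univ_three, d_Xm, d_comm v] at h ⊢
  conv_rhs => arg 2; rw [h]
  abel

theorem iter_Lam (k : ℕ) (m : Fin k → R3) (g : SchwartzMap R3 ℝ) :
    ∂^{m} (Lam g) = Lam (∂^{m} g) + (k : ℝ) • ∂^{m} g := by
  induction k with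
  | zero => simp
  | succ n ih =>
    rw [iteratedLineDerivOp_succ_left, iteratedLineDerivOp_succ_left, ih, lineDerivOp_add,
      lineDerivOp_smul, d_Lam]
    push_cast
    rw [add_smul, one_smul]
    abel

theorem int_mul (f g : SchwartzMap R3 ℝ) : Integrable (fun y => f y * g y) :=
  (SchwartzMap.pairing (ContinuousLinearMap.mul ℝ ℝ) f g).integrable

theorem ibp (i : Fin 3) (g : SchwartzMap R3 ℝ) :
    ∫ y, Xm i (∂_{ee i} g) y * g y = -(1 / 2) * ∫ y, g y * g y := by
  have h := SchwartzMap.integral_mul_lineDerivOp_right_eq_neg_left (μ := volume) (Xm i g) g (ee i)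
  rw [d_Xm] at h
  have h1 : ∀ y, Xm i g y * (∂_{ee i} g) y = Xm i (∂_{ee i} g) y * g y := by
    intro y; rw [Xm_apply, Xm_apply]; ring
  have h2 : ∀ y, (Xm i (∂_{ee i} g) + (ee i) i • g) y * g y
      = Xm i (∂_{ee i} g) y * g y + g y * g y := by
    intro y; simp [ee]; ring
  simp_rw [h1, h2] at h
  rw [integral_add (int_mul _ _) (int_mul _ _)] at h
  linarith

theorem base (g : SchwartzMap R3 ℝ) :
    ∫ y, Lam g y * g y = (1 / 2) * ∫ y, g y * g y := by
  have h2 : ∀ y, Lam g y * g y = 2 * (g y * g y) + ∑ i, Xm i (∂_{ee i} g) y * g y := by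
    intro y; simp [Lam, Fin.sum_univ_three]; ring
  simp_rw [h2]
  rw [integral_add ((int_mul _ _).const_mul _) (integrable_finsetSum _ fun i _ => int_mul _ _),
    integral_finsetSum _ (fun i _ => int_mul _ _), integral_const_mul]
  simp_rw [ibp]
  simp
  ring

/-- for a Schwartz function `f` and any `k ∈ ℕ`,
`∫ ⟨D^k(Λf), D^k f⟩ dy = ((2k+1)/2) ∫ ‖D^k f‖² dy`. -/
theorem stmt6 (f : SchwartzMap R3 ℝ) (k : ℕ) :
    ∫ y : R3, Dinner k (scalingOp fun x => f x) (fun x => f x) y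
      = ((2 * (k : ℝ) + 1) / 2) * ∫ y : R3, Dinner k (fun x => f x) (fun x => f x) y := by
  unfold Dinner
  rw [← Lam_apply]
  have e1 : ∀ (g : SchwartzMap R3 ℝ) (y : R3) (m : Fin k → Fin 3),
      iteratedFDeriv ℝ k (⇑g) y (fun j => EuclideanSpace.single (m j) 1)
        = (∂^{fun j => ee (m j)} g) y := fun g y m =>
    SchwartzMap.iteratedLineDerivOp_eq_iteratedFDeriv.symm
  change ∫ y : R3, ∑ m : Fin k → Fin 3,
    (iteratedFDeriv ℝ k (⇑(Lam f)) y fun j => EuclideanSpace.single (m j) 1) *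
      (iteratedFDeriv ℝ k (⇑f) y fun j => EuclideanSpace.single (m j) 1) =
    ((2 * (k : ℝ) + 1) / 2) * ∫ y : R3, ∑ m : Fin k → Fin 3,
    (iteratedFDeriv ℝ k (⇑f) y fun j => EuclideanSpace.single (m j) 1) *
      (iteratedFDeriv ℝ k (⇑f) y fun j => EuclideanSpace.single (m j) 1)
  simp_rw [e1]
  rw [integral_finsetSum _ (fun i _ => int_mul _ _), integral_finsetSum _ (fun i _ => int_mul _ _),
    Finset.mul_sum]
  refine Finset.sum_congr rfl fun m _ => ?_
  rw [iter_Lam]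
  generalize ∂^{fun j => ee (m j)} f = g
  have h2 : ∀ y, (Lam g + (k : ℝ) • g) y * g y = Lam g y * g y + k * (g y * g y) := by
    intro y; simp; ring
  simp_rw [h2]
  rw [integral_add (int_mul _ _) ((int_mul _ _).const_mul _), integral_const_mul, base]
  ring
end
end

section
/- Let f : ℝ³ → ℝ be a Schwartz function, let L₀f = −Δf + f + (1/2)·y·∇f, and let k ∈ ℕ. Then ∫_{ℝ³} (L₀f)(y)·f(y) dy + ∫_{ℝ³} ⟨ D^k(L₀f)(y), D^k f(y) ⟩ dy ≥ (1/4)·( ∫_{ℝ³} f(y)² dy + ∫_{ℝ³} ‖D^{k+1} f(y)‖² dy ), i.e. the coercivity estimate (L₀f, f)_{H^k} ≥ (1/4)‖f‖²_{H^{k+1}} holds, where (u,v)_{H^k} = (u,v)_{L²} + (D^k u, D^k v)_{L²} and ‖f‖²_{H^{k+1}} = ‖f‖²_{L²} + ‖f‖²_{Ḣ^{k+1}}. -/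
open MeasureTheory Filter Matrix
open scoped RealInnerProductSpace BigOperators

noncomputable section

/-- The operator `L₀f = −Δf + f + (1/2) y·∇f`. -/
def L0 (f : R3 → ℝ) (y : R3) : ℝ := -lap f y + f y + (1 / 2) * fderiv ℝ f y y

open LineDeriv SchwartzMap in
theorem aux_comm (f : SchwartzMap R3 ℝ) (v w : R3) : ∂_{v} (∂_{w} f) = ∂_{w} (∂_{v} f) := by
  have key : ∀ (a b x : R3), (∂_{a} (∂_{b} f)) x = fderiv ℝ (fderiv ℝ f) x a b := by
    intro a b x
    rw [lineDerivOp_apply_eq_fderiv]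
    have h : (⇑(∂_{b} f : SchwartzMap R3 ℝ)) = fun y => fderiv ℝ f y b := rfl
    have hd : DifferentiableAt ℝ (fderiv ℝ f) x := (fderivCLM ℝ R3 ℝ f).differentiableAt
    rw [h, fderiv_clm_apply hd (differentiableAt_const b)]
    simp
  ext x
  rw [key, key]
  have hs : IsSymmSndFDerivAt ℝ (⇑f) x :=
    ((f.smooth 2).contDiffAt).isSymmSndFDerivAt (by simp)
  exact hs v w

theorem aux_tg (i : Fin 3) : (fun y : R3 => y i).HasTemperateGrowth :=
  (EuclideanSpace.proj i : R3 →L[ℝ] ℝ).hasTemperateGrowth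

/-- Multiplication by the coordinate `y i`. -/
def auxX (i : Fin 3) (g : SchwartzMap R3 ℝ) : SchwartzMap R3 ℝ :=
  SchwartzMap.smulLeftCLM ℝ (fun y : R3 => y i) g

theorem auxX_apply (i : Fin 3) (g : SchwartzMap R3 ℝ) (x : R3) : auxX i g x = x i * g x := by
  simp [auxX, SchwartzMap.smulLeftCLM_apply_apply (aux_tg i)]

open LineDeriv SchwartzMap in
theorem aux_dX (i j : Fin 3) (g : SchwartzMap R3 ℝ) (x : R3) :
    (∂_{(EuclideanSpace.single j 1 : R3)} (auxX i g)) x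
      = (if i = j then g x else 0) + x i * (∂_{(EuclideanSpace.single j 1 : R3)} g) x := by
  rw [lineDerivOp_apply_eq_fderiv, lineDerivOp_apply_eq_fderiv]
  have h : (⇑(auxX i g)) = fun y => (EuclideanSpace.proj i : R3 →L[ℝ] ℝ) y * g y := by
    funext y; simp [auxX_apply]
  rw [h, fderiv_fun_mul (ContinuousLinearMap.differentiableAt _) g.differentiableAt,
    ContinuousLinearMap.fderiv]
  by_cases hij : i = j <;> simp [hij] <;> ring

open LineDeriv in
/-- `L₀` on Schwartz functions. -/
def auxL (g : SchwartzMap R3 ℝ) : SchwartzMap R3 ℝ :=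
  -(∑ i : Fin 3, ∂_{(EuclideanSpace.single i 1 : R3)} (∂_{(EuclideanSpace.single i 1 : R3)} g)) + g
    + (1 / 2 : ℝ) • ∑ i : Fin 3, auxX i (∂_{(EuclideanSpace.single i 1 : R3)} g)

open LineDeriv SchwartzMap in
theorem auxL_apply (g : SchwartzMap R3 ℝ) (x : R3) : auxL g x =
    -(∑ i : Fin 3, (∂_{(EuclideanSpace.single i 1 : R3)} (∂_{(EuclideanSpace.single i 1 : R3)} g)) x)
      + g x + (1 / 2 : ℝ) * ∑ i : Fin 3, x i * (∂_{(EuclideanSpace.single i 1 : R3)} g) x := by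
  simp [auxL, auxX_apply]

open LineDeriv SchwartzMap in
theorem auxL_eq (g : SchwartzMap R3 ℝ) : L0 (fun x => g x) = ⇑(auxL g) := by
  funext x
  rw [auxL_apply]
  have hx : ∑ i : Fin 3, x i * (∂_{(EuclideanSpace.single i 1 : R3)} g) x
      = fderiv ℝ (fun x => g x) x x := by
    have hsum : x = ∑ i : Fin 3, x i • (EuclideanSpace.single i 1 : R3) := by
      ext j; simp [Finset.sum_apply, Pi.single_apply]
    conv_rhs => rw [hsum]
    rw [map_sum]
    refine Finset.sum_congr rfl fun i _ => ?_
    rw [map_smul, ← hsum]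
    rfl
  rw [hx]
  rfl

open LineDeriv SchwartzMap in
theorem auxL_comm (j : Fin 3) (g : SchwartzMap R3 ℝ) :
    ∂_{(EuclideanSpace.single j 1 : R3)} (auxL g)
      = auxL (∂_{(EuclideanSpace.single j 1 : R3)} g)
        + (1 / 2 : ℝ) • ∂_{(EuclideanSpace.single j 1 : R3)} g := by
  ext x
  have h1 : ∂_{(EuclideanSpace.single j 1 : R3)} (auxL g) =
    -(∑ i : Fin 3, ∂_{(EuclideanSpace.single i 1 : R3)} (∂_{(EuclideanSpace.single i 1 : R3)}
      (∂_{(EuclideanSpace.single j 1 : R3)} g))) + ∂_{(EuclideanSpace.single j 1 : R3)} g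
    + (1 / 2 : ℝ) • ∑ i : Fin 3, ∂_{(EuclideanSpace.single j 1 : R3)}
        (auxX i (∂_{(EuclideanSpace.single i 1 : R3)} g)) := by
    rw [auxL, lineDerivOp_add, lineDerivOp_add, lineDerivOp_neg, lineDerivOp_smul,
      lineDerivOp_sum, lineDerivOp_sum]
    congr 4
    funext i
    rw [aux_comm, aux_comm g]
  rw [h1]
  simp only [_root_.add_apply, _root_.neg_apply, _root_.sum_apply, _root_.smul_apply, aux_dX, auxL_apply,
    Finset.sum_add_distrib, Finset.sum_ite_eq', Finset.mem_univ, if_true, smul_eq_mul]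
  have : ∀ i : Fin 3, ∂_{(EuclideanSpace.single j 1 : R3)} (∂_{(EuclideanSpace.single i 1 : R3)} g)
    = ∂_{(EuclideanSpace.single i 1 : R3)} (∂_{(EuclideanSpace.single j 1 : R3)} g) :=
    fun i => aux_comm g _ _
  simp only [this]
  ring

open LineDeriv SchwartzMap in
theorem auxL_iter (k : ℕ) (m : Fin k → Fin 3) (g : SchwartzMap R3 ℝ) :
    ∂^{fun j => (EuclideanSpace.single (m j) 1 : R3)} (auxL g)
      = auxL (∂^{fun j => (EuclideanSpace.single (m j) 1 : R3)} g)
        + ((k : ℝ) / 2) • ∂^{fun j => (EuclideanSpace.single (m j) 1 : R3)} g := by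
  induction k with
  | zero => simp
  | succ k ih =>
    rw [iteratedLineDerivOp_succ_left, iteratedLineDerivOp_succ_left]
    have := ih (Fin.tail m)
    have ht : Fin.tail (fun j => (EuclideanSpace.single (m j) 1 : R3))
      = fun j => (EuclideanSpace.single (Fin.tail m j) 1 : R3) := rfl
    rw [ht, this, lineDerivOp_add, lineDerivOp_smul, auxL_comm, add_assoc, ← add_smul]
    push_cast
    congr 2
    ring

theorem aux_int (f g : SchwartzMap R3 ℝ) : Integrable (fun x => f x * g x) :=
  (f.memLp 2).integrable_mul (g.memLp 2)

open LineDeriv SchwartzMap in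
theorem aux_energy (g : SchwartzMap R3 ℝ) :
    ∫ x, auxL g x * g x = (∑ i : Fin 3, ∫ x, (∂_{(EuclideanSpace.single i 1 : R3)} g) x *
      (∂_{(EuclideanSpace.single i 1 : R3)} g) x) + (1 / 4) * ∫ x, g x * g x := by
  have hA : ∀ i : Fin 3, ∫ x, (∂_{(EuclideanSpace.single i 1 : R3)}
      (∂_{(EuclideanSpace.single i 1 : R3)} g)) x * g x
      = - ∫ x, (∂_{(EuclideanSpace.single i 1 : R3)} g) x *
      (∂_{(EuclideanSpace.single i 1 : R3)} g) x := by
    intro i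
    have := integral_mul_lineDerivOp_right_eq_neg_left (μ := volume)
      (∂_{(EuclideanSpace.single i 1 : R3)} g) g (EuclideanSpace.single i 1 : R3)
    linarith
  have hB : ∀ i : Fin 3, ∫ x, auxX i (∂_{(EuclideanSpace.single i 1 : R3)} g) x * g x
      = - (1 / 2) * ∫ x, g x * g x := by
    intro i
    have h := integral_mul_lineDerivOp_right_eq_neg_left (μ := volume)
      (auxX i g) g (EuclideanSpace.single i 1 : R3)
    have h1 : ∀ x, auxX i g x * (∂_{(EuclideanSpace.single i 1 : R3)} g) x
      = auxX i (∂_{(EuclideanSpace.single i 1 : R3)} g) x * g x := by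
      intro x; rw [auxX_apply, auxX_apply]; ring
    have h2 : ∀ x, (∂_{(EuclideanSpace.single i 1 : R3)} (auxX i g)) x * g x
      = g x * g x + auxX i (∂_{(EuclideanSpace.single i 1 : R3)} g) x * g x := by
      intro x; rw [aux_dX, auxX_apply]; simp; ring
    simp only [h1, h2] at h
    rw [integral_add (aux_int _ _) (aux_int _ _)] at h
    linarith
  have hpt : ∀ x, auxL g x * g x = (-(∑ i : Fin 3, (∂_{(EuclideanSpace.single i 1 : R3)}
      (∂_{(EuclideanSpace.single i 1 : R3)} g)) x * g x) + g x * g x)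
      + (1 / 2 : ℝ) * ∑ i : Fin 3, auxX i (∂_{(EuclideanSpace.single i 1 : R3)} g) x * g x := by
    intro x
    simp only [auxL_apply, auxX_apply, ← Finset.sum_mul]
    ring
  have i1 : Integrable (fun x => ∑ i : Fin 3, (∂_{(EuclideanSpace.single i 1 : R3)}
      (∂_{(EuclideanSpace.single i 1 : R3)} g)) x * g x) :=
    integrable_finsetSum _ fun i _ => aux_int _ _
  have i2 : Integrable (fun x => ∑ i : Fin 3,
      auxX i (∂_{(EuclideanSpace.single i 1 : R3)} g) x * g x) :=
    integrable_finsetSum _ fun i _ => aux_int _ _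
  have i3 : Integrable (fun x => -(∑ i : Fin 3, (∂_{(EuclideanSpace.single i 1 : R3)}
      (∂_{(EuclideanSpace.single i 1 : R3)} g)) x * g x)) := i1.neg
  have i4 : Integrable (fun x => -(∑ i : Fin 3, (∂_{(EuclideanSpace.single i 1 : R3)}
      (∂_{(EuclideanSpace.single i 1 : R3)} g)) x * g x) + g x * g x) := i3.add (aux_int _ _)
  simp only [hpt]
  rw [integral_add i4 (i2.const_mul _), integral_add i3 (aux_int _ _),
    integral_neg, integral_const_mul, integral_finsetSum _ fun i _ => aux_int _ _,
    integral_finsetSum _ fun i _ => aux_int _ _]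
  simp only [hA, hB]
  simp [Fin.sum_univ_three]
  ring

open LineDeriv SchwartzMap in
theorem aux_Dinner (k : ℕ) (f g : SchwartzMap R3 ℝ) :
    ∫ y, Dinner k (⇑f) (⇑g) y = ∑ m : Fin k → Fin 3, 
      ∫ y, (∂^{fun j => (EuclideanSpace.single (m j) 1 : R3)} f) y
        * (∂^{fun j => (EuclideanSpace.single (m j) 1 : R3)} g) y := by
  simp only [Dinner, ← iteratedLineDerivOp_eq_iteratedFDeriv]
  exact integral_finsetSum _ fun i _ => aux_int _ _

/-- coercivity of `L₀` in `H^k`: for a Schwartz function `f` and `k ∈ ℕ`,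
`(L₀f, f)_{L²} + (D^k(L₀f), D^k f)_{L²} ≥ (1/4)(‖f‖²_{L²} + ‖D^{k+1}f‖²_{L²})`,
i.e. `(L₀f, f)_{H^k} ≥ (1/4)‖f‖²_{H^{k+1}}`. -/
theorem stmt7 (f : SchwartzMap R3 ℝ) (k : ℕ) :
    (∫ y : R3, L0 (fun x => f x) y * f y)
        + (∫ y : R3, Dinner k (L0 fun x => f x) (fun x => f x) y)
      ≥ (1 / 4) * ((∫ y : R3, f y ^ 2)
        + ∫ y : R3, Dinner (k + 1) (fun x => f x) (fun x => f x) y) := by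
  have hf : (fun x => f x) = ⇑f := rfl
  have hpos : ∀ g : SchwartzMap R3 ℝ, 0 ≤ ∫ x, g x * g x := fun g =>
    integral_nonneg fun x => mul_self_nonneg _
  have hE1 : (∫ y : R3, L0 (fun x => f x) y * f y) ≥ (1 / 4) * ∫ y : R3, f y ^ 2 := by
    rw [auxL_eq, aux_energy]
    simp only [pow_two]
    have := Finset.sum_nonneg fun (i : Fin 3) (_ : i ∈ Finset.univ) =>
      hpos (LineDeriv.lineDerivOp (EuclideanSpace.single i 1 : R3) f)
    linarith
  have hE2 : (∫ y : R3, Dinner k (L0 fun x => f x) (fun x => f x) y)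
      ≥ ∫ y : R3, Dinner (k + 1) (fun x => f x) (fun x => f x) y := by
    rw [auxL_eq, hf, aux_Dinner, aux_Dinner, ← (Fin.consEquiv fun _ => Fin 3).sum_comp,
      Fintype.sum_prod_type, Finset.sum_comm]
    refine Finset.sum_le_sum fun m _ => ?_
    rw [auxL_iter]
    set g := LineDeriv.iteratedLineDerivOp
      (fun j => (EuclideanSpace.single (m j) 1 : R3)) f with hg
    have h1 : ∫ y, (auxL g + ((k : ℝ) / 2) • g) y * g y
        = (∫ y, auxL g y * g y) + ((k : ℝ) / 2) * ∫ y, g y * g y := by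
      rw [← integral_const_mul, ← integral_add (aux_int _ _) ((aux_int _ _).const_mul _)]
      refine integral_congr_ae (Eventually.of_forall fun y => ?_)
      simp only [_root_.add_apply, _root_.smul_apply, smul_eq_mul]
      ring
    rw [h1, aux_energy]
    have h2 : ∀ i : Fin 3, LineDeriv.iteratedLineDerivOp
      (fun j => (EuclideanSpace.single ((Fin.consEquiv fun _ => Fin 3) (i, m) j) 1 : R3)) f
      = LineDeriv.lineDerivOp (EuclideanSpace.single i 1 : R3) g := by
      intro i
      rw [LineDeriv.iteratedLineDerivOp_succ_left]
      rfl
    simp only [h2]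
    have := hpos g
    have hk : 0 ≤ ((k : ℝ) / 2) * ∫ y, g y * g y := by positivity
    linarith
  have h3 : 0 ≤ ∫ y : R3, Dinner (k + 1) (fun x => f x) (fun x => f x) y :=
    integral_nonneg fun y => Finset.sum_nonneg fun m _ => mul_self_nonneg _
  linarith
end
end

section
/- Let Q : ℝ³ → ℝ be defined by Q(y) = 4(6+|y|²)/(2+|y|²)², and let g : ℝ³ → ℝ be defined by g(y) = 4y₃/(2+|y|²), where y = (y₁,y₂,y₃). Then for every y ∈ ℝ³: (i) Δg(y) = ∂₃Q(y), i.e. g = Δ⁻¹∂₃Q; and (ii) ∂₃g(y) = (8 + 4|y|² − 8y₃²)/(2+|y|²)². -/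
open MeasureTheory Filter Matrix
open scoped RealInnerProductSpace BigOperators

noncomputable section

/-- `g(y) = 4y₃/(2+|y|²)`, an explicit solution of `Δg = ∂₃Q`. -/
def gPot (y : R3) : ℝ := 4 * y 2 / (2 + ‖y‖ ^ 2)

lemma hasFD_den (y : R3) :
    HasFDerivAt (fun x : R3 => 2 + ‖x‖ ^ 2) (2 • innerSL ℝ y) y :=
  (hasStrictFDerivAt_norm_sq y).hasFDerivAt.const_add 2

lemma hasFD_coord (j : Fin 3) (y : R3) :
    HasFDerivAt (fun x : R3 => x j) (EuclideanSpace.proj j : R3 →L[ℝ] ℝ) y :=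
  (EuclideanSpace.proj j : R3 →L[ℝ] ℝ).hasFDerivAt

lemma den_ne (y : R3) : 2 + ‖y‖ ^ 2 ≠ 0 := by positivity

lemma inner_e (y : R3) (i : Fin 3) : inner ℝ y (EuclideanSpace.single i (1:ℝ)) = y i := by
  simp [EuclideanSpace.inner_single_right]

lemma fderiv_g (y : R3) (i : Fin 3) :
    fderiv ℝ gPot y (EuclideanSpace.single i 1) =
      (4 * (if i = 2 then 1 else 0)) * (2 + ‖y‖ ^ 2)⁻¹
        - 8 * (y 2 * y i) * ((2 + ‖y‖ ^ 2)⁻¹ * (2 + ‖y‖ ^ 2)⁻¹) := by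
  have h := ((hasFD_coord 2 y).const_mul 4).mul ((hasDerivAt_inv (den_ne y)).comp_hasFDerivAt y (hasFD_den y))
  have e : gPot = (fun x : R3 => 4 * x 2) * ((fun t : ℝ => t⁻¹) ∘ fun x : R3 => 2 + ‖x‖ ^ 2) := by
    funext x; simp [gPot, div_eq_mul_inv]
  rw [e, HasFDerivAt.fderiv h]
  have := den_ne y
  fin_cases i <;> simp [inner_e] <;> field_simp <;> ring

lemma fderiv_Q (y : R3) (i : Fin 3) :
    fderiv ℝ Q y (EuclideanSpace.single i 1) =
      - 8 * y i * (10 + ‖y‖ ^ 2) / (2 + ‖y‖ ^ 2) ^ 3 := by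
  have hi := (hasDerivAt_inv (den_ne y)).comp_hasFDerivAt y (hasFD_den y)
  have h := (hi.const_mul 4).add ((hi.mul hi).const_mul 16)
  have e : Q = fun x : R3 => 4 * (2 + ‖x‖ ^ 2)⁻¹ + 16 * ((2 + ‖x‖ ^ 2)⁻¹ * (2 + ‖x‖ ^ 2)⁻¹) := by
    funext x
    have := den_ne x
    simp only [Q]; field_simp; ring
  rw [e]
  refine (congrArg (fun L => L (EuclideanSpace.single i 1)) (HasFDerivAt.fderiv h)).trans ?_
  have := den_ne y
  simp [inner_e]
  field_simp
  ring

lemma fderiv_gg (y : R3) (i : Fin 3) :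
    fderiv ℝ (fun x => fderiv ℝ gPot x (EuclideanSpace.single i 1)) y (EuclideanSpace.single i 1) =
      (4 * (if i = 2 then 1 else 0)) * (-(2 * y i) / (2 + ‖y‖ ^ 2) ^ 2)
        - 8 * ((if i = 2 then 1 else 0) * y i + y 2) / (2 + ‖y‖ ^ 2) ^ 2
        + 32 * y 2 * y i ^ 2 / (2 + ‖y‖ ^ 2) ^ 3 := by
  have hi := (hasDerivAt_inv (den_ne y)).comp_hasFDerivAt y (hasFD_den y)
  have h := (hi.const_mul (4 * (if i = 2 then 1 else 0))).sub
    ((((hasFD_coord 2 y).mul (hasFD_coord i y)).const_mul 8).mul (hi.mul hi))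
  rw [funext fun x => fderiv_g x i]
  refine (congrArg (fun L => L (EuclideanSpace.single i 1)) (HasFDerivAt.fderiv h)).trans ?_
  have := den_ne y
  fin_cases i <;> simp [inner_e] <;> field_simp <;> ring

/-- for every `y ∈ ℝ³`, (i) `Δg(y) = ∂₃Q(y)`, i.e. `g = Δ⁻¹∂₃Q`; and
(ii) `∂₃g(y) = (8 + 4|y|² − 8y₃²)/(2+|y|²)²`. -/
theorem stmt13 : ∀ y : R3,
    lap gPot y = fderiv ℝ Q y (EuclideanSpace.single 2 1) ∧
    fderiv ℝ gPot y (EuclideanSpace.single 2 1)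
      = (8 + 4 * ‖y‖ ^ 2 - 8 * (y 2) ^ 2) / (2 + ‖y‖ ^ 2) ^ 2 := by
  intro y
  have hd := den_ne y
  have hn : ‖y‖ ^ 2 = y 0 ^ 2 + y 1 ^ 2 + y 2 ^ 2 := by
    simp [EuclideanSpace.norm_sq_eq, Fin.sum_univ_three]
  constructor
  · rw [fderiv_Q, lap, Fin.sum_univ_three, fderiv_gg, fderiv_gg, fderiv_gg]
    rw [hn] at hd ⊢
    simp
    field_simp
    ring
  · rw [fderiv_g]
    simp
    field_simp
    ring
end
end

section
/- Let Q : ℝ³ → ℝ be defined by Q(y) = 4(6+|y|²)/(2+|y|²)², and let g : ℝ³ → ℝ be defined by g(y) = 4y₃/(2+|y|²). Then for every y ∈ ℝ³, Q(y) − ∂₃g(y) = 8(2+y₃²)/(2+|y|²)² ≥ 16/(2+|y|²)² > 0. In particular, the third component of the Leray projection of the buoyancy profile, (P(Qe₃))₃ = Q − ∂₃Δ⁻¹∂₃Q, is strictly positive everywhere, and its value at y = 0 is 4, while (∂₃Δ⁻¹∂₃Q)(0) = ∂₃g(0) = 2. -/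
open MeasureTheory Filter Matrix
open scoped RealInnerProductSpace BigOperators

noncomputable section

theorem fderiv_gPot_apply (y : R3) : fderiv ℝ gPot y (EuclideanSpace.single 2 1)
    = 4 / (2 + ‖y‖ ^ 2) - 8 * (y 2) ^ 2 / (2 + ‖y‖ ^ 2) ^ 2 := by
  have hpos : (2 + ‖y‖ ^ 2 : ℝ) ≠ 0 := by positivity
  have h1 : HasFDerivAt (fun x : R3 => 4 * x 2)
      ((4 : ℝ) • (EuclideanSpace.proj 2 : R3 →L[ℝ] ℝ)) y :=
    ((EuclideanSpace.proj 2 : R3 →L[ℝ] ℝ).hasFDerivAt).const_mul 4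
  have h2 : HasFDerivAt (fun x : R3 => 2 + ‖x‖ ^ 2) (2 • (innerSL ℝ y)) y :=
    ((hasStrictFDerivAt_norm_sq y).hasFDerivAt).const_add 2
  have h3 : HasFDerivAt gPot _ y :=
    h1.mul ((hasDerivAt_inv hpos).comp_hasFDerivAt y h2)
  rw [h3.fderiv]
  simp [EuclideanSpace.inner_single_right]
  field_simp
  ring

/-- the third component of the Leray projection of the buoyancy profile,
`(P(Qe₃))₃ = Q − ∂₃Δ⁻¹∂₃Q = Q − ∂₃g`, equals `8(2+y₃²)/(2+|y|²)²`, is at least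
`16/(2+|y|²)²`, hence strictly positive; it equals `4` at `y = 0`, while `∂₃g(0) = 2`. -/
theorem stmt14 :
    (∀ y : R3, Q y - fderiv ℝ gPot y (EuclideanSpace.single 2 1)
      = 8 * (2 + (y 2) ^ 2) / (2 + ‖y‖ ^ 2) ^ 2) ∧
    (∀ y : R3, 16 / (2 + ‖y‖ ^ 2) ^ 2
      ≤ Q y - fderiv ℝ gPot y (EuclideanSpace.single 2 1)) ∧
    (∀ y : R3, 0 < Q y - fderiv ℝ gPot y (EuclideanSpace.single 2 1)) ∧
    Q 0 - fderiv ℝ gPot 0 (EuclideanSpace.single 2 1) = 4 ∧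
    fderiv ℝ gPot 0 (EuclideanSpace.single 2 1) = 2 := by
  have key : ∀ y : R3, Q y - fderiv ℝ gPot y (EuclideanSpace.single 2 1)
      = 8 * (2 + (y 2) ^ 2) / (2 + ‖y‖ ^ 2) ^ 2 := by
    intro y
    have hpos : (2 + ‖y‖ ^ 2 : ℝ) ≠ 0 := by positivity
    rw [fderiv_gPot_apply, Q]
    field_simp
    ring
  refine ⟨key, ?_, ?_, ?_, ?_⟩
  · intro y
    rw [key]
    gcongr
    nlinarith [sq_nonneg (y 2)]
  · intro y
    rw [key]
    positivity
  · rw [key]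
    norm_num
  · rw [fderiv_gPot_apply]
    norm_num
end
end
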